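/- arXiv:1312.1917 — 3 statements merged into one kernel-verified Lean document; each statement's English description precedes it below -/
import Mathlib

section
/- For all natural numbers s ≥ 1 and j ≥ 0, the inequality Σ_{h=0}^{j} h·(h+1)^{s−1} ≥ (B_{s+1}(j+1) − B_{s+1}(0))/(s+1) holds in ℚ, where B_{s+1} is the (s+1)-st Bernoulli polynomial. -/
open Polynomial

/-- For `s ≥ 1` and `j ≥ 0`,
`∑_{h=0}^{j} h * (h+1)^(s-1) ≥ (B_{s+1}(j+1) - B_{s+1}(0)) / (s+1)` in `ℚ`. -/
theorem stmt2 (s j : ℕ) (hs : 1 ≤ s) :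
    ∑ h ∈ Finset.range (j + 1), (h : ℚ) * ((h : ℚ) + 1) ^ (s - 1) ≥
      ((Polynomial.bernoulli (s + 1)).eval ((j : ℚ) + 1)
        - (Polynomial.bernoulli (s + 1)).eval 0) / (s + 1) := by
  have hsum := Polynomial.sum_range_pow_eq_bernoulli_sub (j + 1) s
  push_cast at hsum
  rw [Polynomial.bernoulli_eval_zero, ← hsum, mul_div_cancel_left₀ _ (by positivity), ge_iff_le]
  refine Finset.sum_le_sum fun h _ => ?_
  calc (h : ℚ) ^ s = h * (h : ℚ) ^ (s - 1) := (mul_pow_sub_one (by lia) _).symm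
    _ ≤ h * ((h : ℚ) + 1) ^ (s - 1) := by
      gcongr
      linarith
end

section
/- For all natural numbers s ≥ 2 and j ≥ 1, the strict inequality Σ_{h=0}^{j} h·(h+1)^{s−1} > (B_{s+1}(j+1) − B_{s+1}(0))/(s+1) holds in ℚ, where B_{s+1} is the (s+1)-st Bernoulli polynomial. -/
open Polynomial

/-- For `s ≥ 2` and `j ≥ 1`,
`∑_{h=0}^{j} h * (h+1)^(s-1) > (B_{s+1}(j+1) - B_{s+1}(0)) / (s+1)` in `ℚ`. -/
theorem stmt3 (s j : ℕ) (hs : 2 ≤ s) (hj : 1 ≤ j) :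
    ∑ h ∈ Finset.range (j + 1), (h : ℚ) * ((h : ℚ) + 1) ^ (s - 1) >
      ((Polynomial.bernoulli (s + 1)).eval ((j : ℚ) + 1)
        - (Polynomial.bernoulli (s + 1)).eval 0) / (s + 1) := by
  have key := sum_range_pow_eq_bernoulli_sub (j + 1) s
  push_cast at key
  rw [bernoulli_eval_zero, ← key, mul_div_cancel_left₀ _ (by positivity : (s : ℚ) + 1 ≠ 0)]
  obtain ⟨m, rfl⟩ : ∃ m, s = m + 1 := ⟨s - 1, by omega⟩
  simp only [Nat.add_sub_cancel, pow_succ', gt_iff_lt]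
  refine Finset.sum_lt_sum (fun h _ => ?_) ⟨1, Finset.mem_range.2 (by omega), ?_⟩
  · gcongr
    linarith
  · have : (1 : ℚ) < (1 + 1) ^ m := one_lt_pow₀ (by norm_num) (by omega)
    simpa using this
end

section
/- Let s ≥ 1 be a natural number, g > 0 a real number, and set c = 2^{−(3s+1)/s}·(s/g)^{1/s} (real powers). There exists a natural number M such that for all natural numbers j ≥ M, c·(g·(B_s(j+2) − B_s(0))/s)^{(s+1)/s} ≤ g·(B_{s+1}(j+1) − B_{s+1}(0))/(s+1), where B_s and B_{s+1} denote the Bernoulli polynomials. -/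
open Polynomial

/-- The sum-of-powers identity for Bernoulli polynomials, evaluated in `ℝ`. -/
theorem aeval_bernoulli_sub_aeval_zero (p n : ℕ) :
    aeval (n : ℝ) (Polynomial.bernoulli (p + 1)) - aeval (0 : ℝ) (Polynomial.bernoulli (p + 1))
      = ((p : ℝ) + 1) * ∑ k ∈ Finset.range n, (k : ℝ) ^ p := by
  have h := Polynomial.bernoulli_succ_eval n p
  have h₁ : aeval (n : ℝ) (Polynomial.bernoulli (p + 1))
      = (((Polynomial.bernoulli (p + 1)).eval (n : ℚ) : ℚ) : ℝ) := by
    simpa using aeval_algebraMap_apply ℝ (n : ℚ) (Polynomial.bernoulli (p + 1))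
  have h₀ : aeval (0 : ℝ) (Polynomial.bernoulli (p + 1))
      = (((Polynomial.bernoulli (p + 1)).eval (0 : ℚ) : ℚ) : ℝ) := by
    simpa using aeval_algebraMap_apply ℝ (0 : ℚ) (Polynomial.bernoulli (p + 1))
  rw [h₁, h₀, Polynomial.bernoulli_eval_zero, ← Nat.succ_eq_add_one, h]
  push_cast
  ring

theorem pow_succ_add_mul_pow_le_add_one_pow {a : ℝ} (ha : 0 ≤ a) (p : ℕ) :
    a ^ (p + 1) + ((p : ℝ) + 1) * a ^ p ≤ (a + 1) ^ (p + 1) := by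
  induction p with
  | zero => simp
  | succ p ih =>
    have h := mul_le_mul_of_nonneg_left ih (by positivity : 0 ≤ a + 1)
    have h' : 0 ≤ ((p : ℝ) + 1) * a ^ p := by positivity
    push_cast
    ring_nf at h h' ⊢
    linarith

theorem add_one_pow_le_pow_succ_add_mul_pow {a : ℝ} (ha : 0 ≤ a) (p : ℕ) :
    (a + 1) ^ (p + 1) ≤ a ^ (p + 1) + ((p : ℝ) + 1) * (a + 1) ^ p := by
  induction p with
  | zero => simp
  | succ p ih =>
    have h := mul_le_mul_of_nonneg_left ih ha
    have h' : 0 ≤ ((p : ℝ) + 1) * (a + 1) ^ p := by positivity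
    push_cast
    have e₁ : (a + 1) ^ (p + 1 + 1) = a * (a + 1) ^ (p + 1) + (a + 1) ^ (p + 1) := by ring
    have e₂ : ((p : ℝ) + 1 + 1) * (a + 1) ^ (p + 1) = a * (((p : ℝ) + 1) * (a + 1) ^ p)
      + ((p : ℝ) + 1) * (a + 1) ^ p + (a + 1) ^ (p + 1) := by ring
    rw [e₁, e₂, pow_succ' a (p + 1)]
    linarith

theorem mul_sum_range_pow_le_pow_succ (p n : ℕ) :
    ((p : ℝ) + 1) * ∑ k ∈ Finset.range n, (k : ℝ) ^ p ≤ (n : ℝ) ^ (p + 1) := by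
  induction n with
  | zero => simp
  | succ n ih =>
    have h := pow_succ_add_mul_pow_le_add_one_pow n.cast_nonneg (a := (n : ℝ)) p
    rw [Finset.sum_range_succ, mul_add]
    push_cast
    linarith

theorem pow_succ_le_mul_sum_range_succ_pow (p n : ℕ) :
    (n : ℝ) ^ (p + 1) ≤ ((p : ℝ) + 1) * ∑ k ∈ Finset.range (n + 1), (k : ℝ) ^ p := by
  induction n with
  | zero => simp; positivity
  | succ n ih =>
    have h := add_one_pow_le_pow_succ_add_mul_pow n.cast_nonneg (a := (n : ℝ)) p
    rw [Finset.sum_range_succ, mul_add]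
    push_cast
    linarith

theorem add_two_pow_le_four_mul_pow {m : ℕ} {x : ℝ} (hx : 0 ≤ x) (h : 4 * (m : ℝ) ≤ x) :
    (x + 2) ^ m ≤ 4 * x ^ m := by
  have hpos : 0 < x + 2 := by linarith
  have hle : 2 / (x + 2) ≤ 1 := by rw [div_le_one hpos]; linarith
  have hb := one_add_mul_le_pow (a := -(2 / (x + 2))) (by linarith) m
  have hm : (m : ℝ) * (2 / (x + 2)) ≤ 3 / 4 := by
    rw [mul_div_assoc', div_le_iff₀ hpos]; linarith
  have e : 1 + -(2 / (x + 2)) = x / (x + 2) := by field_simp; ring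
  rw [e, div_pow] at hb
  have : 1 / 4 ≤ x ^ m / (x + 2) ^ m := by linarith
  rw [le_div_iff₀ (by positivity)] at this
  linarith

theorem rpow_mul_rpow_le_of_le_pow {s : ℕ} (hs : 1 ≤ s) {g D x : ℝ} (hg : 0 < g) (hD : 0 ≤ D)
    (hx : 0 ≤ x) (hDx : D ≤ x ^ s) :
    (2 : ℝ) ^ (-(3 * (s : ℝ) + 1) / s) * ((s : ℝ) / g) ^ ((1 : ℝ) / s)
      * (g * D / s) ^ (((s : ℝ) + 1) / s) ≤ 1 / 8 * (g / s) * x ^ (s + 1) := by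
  have hs0 : (0 : ℝ) < s := by exact_mod_cast hs
  have h2 : (2 : ℝ) ^ (-(3 * (s : ℝ) + 1) / s) ≤ 1 / 8 := by
    calc (2 : ℝ) ^ (-(3 * (s : ℝ) + 1) / s) ≤ (2 : ℝ) ^ (-3 : ℝ) := by
          apply Real.rpow_le_rpow_of_exponent_le one_le_two
          rw [div_le_iff₀ hs0]; linarith
      _ = 1 / 8 := by
          rw [Real.rpow_neg two_pos.le]; norm_num
  have hbase : (g * D / s) ^ (((s : ℝ) + 1) / s)
      ≤ (g / s * x ^ s) ^ (((s : ℝ) + 1) / s) := by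
    apply Real.rpow_le_rpow (by positivity) _ (by positivity)
    rw [mul_div_right_comm]
    gcongr
  have hpow : (x ^ s) ^ (((s : ℝ) + 1) / s) = x ^ (s + 1) := by
    rw [← Real.rpow_natCast x s, ← Real.rpow_mul hx, mul_div_cancel₀ _ hs0.ne',
      ← Real.rpow_natCast x (s + 1)]
    push_cast
    rfl
  have hgs : ((s : ℝ) / g) ^ ((1 : ℝ) / s) * (g / s) ^ (((s : ℝ) + 1) / s) = g / s := by
    have e : ((s : ℝ) + 1) / s = 1 / s + 1 := by field_simp; ring
    rw [e, Real.rpow_add (by positivity), Real.rpow_one, ← mul_assoc,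
      ← Real.mul_rpow (by positivity) (by positivity), div_mul_div_cancel₀ hg.ne',
      div_self hs0.ne', Real.one_rpow, one_mul]
  calc _ ≤ 1 / 8 * ((s : ℝ) / g) ^ ((1 : ℝ) / s)
        * (g / s * x ^ s) ^ (((s : ℝ) + 1) / s) := by gcongr
    _ = 1 / 8 * (((s : ℝ) / g) ^ ((1 : ℝ) / s) * (g / s) ^ (((s : ℝ) + 1) / s))
        * x ^ (s + 1) := by
      rw [Real.mul_rpow (by positivity) (by positivity), hpow]; ring
    _ = _ := by rw [hgs]

/-- For `s ≥ 1`, `g > 0` and `c = 2^(-(3s+1)/s) * (s/g)^(1/s)` (real powers), there is a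
natural number `M` such that for all `j ≥ M`,
`c * (g * (B_s(j+2) - B_s(0)) / s)^((s+1)/s) ≤ g * (B_{s+1}(j+1) - B_{s+1}(0)) / (s+1)`. -/
theorem stmt13 (s : ℕ) (hs : 1 ≤ s) (g : ℝ) (hg : 0 < g)
    (c : ℝ) (hc : c = (2 : ℝ) ^ (-(3 * (s : ℝ) + 1) / s) * ((s : ℝ) / g) ^ ((1 : ℝ) / s)) :
    ∃ M : ℕ, ∀ j : ℕ, M ≤ j →
      c * (g * (Polynomial.aeval ((j : ℝ) + 2) (Polynomial.bernoulli s)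
            - Polynomial.aeval (0 : ℝ) (Polynomial.bernoulli s)) / s) ^ (((s : ℝ) + 1) / s)
        ≤ g * (Polynomial.aeval ((j : ℝ) + 1) (Polynomial.bernoulli (s + 1))
            - Polynomial.aeval (0 : ℝ) (Polynomial.bernoulli (s + 1))) / (s + 1) := by
  refine ⟨4 * (s + 1), fun j hj => ?_⟩
  obtain ⟨p, rfl⟩ : ∃ p, s = p + 1 := ⟨s - 1, by omega⟩
  have hX := aeval_bernoulli_sub_aeval_zero p (j + 2)
  have hY := aeval_bernoulli_sub_aeval_zero (p + 1) (j + 1)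
  have hXle := mul_sum_range_pow_le_pow_succ p (j + 2)
  have hYge := pow_succ_le_mul_sum_range_succ_pow (p + 1) j
  have hX0 : 0 ≤ ((p : ℝ) + 1) * ∑ k ∈ Finset.range (j + 2), (k : ℝ) ^ p := by positivity
  rw [← hX] at hXle hX0
  rw [← hY] at hYge
  rw [Nat.cast_add j 2, Nat.cast_ofNat] at hXle hX0
  rw [Nat.cast_add j 1, Nat.cast_one] at hYge
  have hj4 : 4 * ((p + 1 + 1 : ℕ) : ℝ) ≤ (j : ℝ) := by exact_mod_cast hj
  have h4 := add_two_pow_le_four_mul_pow j.cast_nonneg hj4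
  rw [hc]
  refine (rpow_mul_rpow_le_of_le_pow hs hg hX0 (by positivity) hXle).trans ?_
  calc 1 / 8 * (g / ((p + 1 : ℕ) : ℝ)) * ((j : ℝ) + 2) ^ (p + 1 + 1)
      ≤ 1 / 8 * (g / ((p + 1 : ℕ) : ℝ)) * (4 * (j : ℝ) ^ (p + 1 + 1)) := by gcongr
    _ = g * (j : ℝ) ^ (p + 1 + 1) / (2 * ((p + 1 : ℕ) : ℝ)) := by field_simp; ring
    _ ≤ g * (j : ℝ) ^ (p + 1 + 1) / (((p + 1 : ℕ) : ℝ) + 1) := by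
      gcongr
      have : (1 : ℝ) ≤ ((p + 1 : ℕ) : ℝ) := by exact_mod_cast hs
      linarith
    _ ≤ _ := by gcongr
end
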